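/- arXiv:1403.7776 — 2 statements merged into one kernel-verified Lean document; each statement's English description precedes it below -/
import Mathlib

section
/- Let ε be a splitting on an open set U ⊆ ℝⁿ. Then for all p, x ∈ U and all indices i,j,k: ε^a_k(x,p) · (∂ε^i_a(p,y)/∂y^j)|_{y=x} = Γ^i_{jk}(x). In particular, the left-hand side is independent of the choice of basepoint p. -/
noncomputable section

open Set

/-- The `j`-th coordinate partial derivative of a real-valued function on `ℝⁿ`. -/
noncomputable def pd {n : ℕ} (j : Fin n) (f : (Fin n → ℝ) → ℝ) (x : Fin n → ℝ) : ℝ :=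
  fderiv ℝ f x (Pi.single j 1)

/-- A splitting `ε` on `U`: a smooth groupoid homomorphism `U × U → GL(n,ℝ)`
satisfying `ε(z,y)ε(x,z) = ε(x,y)` and `ε(x,x) = id`. -/
structure IsSplitting {n : ℕ} (U : Set (Fin n → ℝ))
    (eps : (Fin n → ℝ) → (Fin n → ℝ) → Fin n → Fin n → ℝ) : Prop where
  smooth : ∀ i j : Fin n, ContDiffOn ℝ (⊤ : ℕ∞)
    (fun p : (Fin n → ℝ) × (Fin n → ℝ) => eps p.1 p.2 i j) (U ×ˢ U)
  comp : ∀ x ∈ U, ∀ y ∈ U, ∀ z ∈ U, ∀ i j : Fin n,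
    (∑ a, eps z y i a * eps x z a j) = eps x y i j
  refl : ∀ x ∈ U, ∀ i j : Fin n, eps x x i j = if i = j then (1 : ℝ) else 0

/-- `Γ^i_{jk}(x) = (∂ε^i_k(x,y)/∂y^j)|_{y=x}`. -/
noncomputable def Gam {n : ℕ} (eps : (Fin n → ℝ) → (Fin n → ℝ) → Fin n → Fin n → ℝ)
    (i j k : Fin n) (x : Fin n → ℝ) : ℝ :=
  pd j (fun y => eps x y i k) x

/-- The groupoid curvature `R^i_{jk}(x,y)`. -/
noncomputable def Rg {n : ℕ} (eps : (Fin n → ℝ) → (Fin n → ℝ) → Fin n → Fin n → ℝ)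
    (i j k : Fin n) (x y : Fin n → ℝ) : ℝ :=
  pd j (fun x' => eps x' y i k) x + ∑ a, pd a (fun y' => eps x y' i k) y * eps x y a j
    - pd k (fun x' => eps x' y i j) x - ∑ a, pd a (fun y' => eps x y' i j) y * eps x y a k

/-- The algebroid curvature `𝔯^i_{jk,r}(x)`. -/
noncomputable def ra {n : ℕ} (eps : (Fin n → ℝ) → (Fin n → ℝ) → Fin n → Fin n → ℝ)
    (i j k r : Fin n) (x : Fin n → ℝ) : ℝ :=
  pd j (Gam eps i r k) x + ∑ a, Gam eps a r j x * Gam eps i a k x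
    - pd k (Gam eps i r j) x - ∑ a, Gam eps a r k x * Gam eps i a j x

/-- The torsion `T^i_{jk} = Γ^i_{jk} − Γ^i_{kj}`. -/
noncomputable def Tor {n : ℕ} (eps : (Fin n → ℝ) → (Fin n → ℝ) → Fin n → Fin n → ℝ)
    (i j k : Fin n) (x : Fin n → ℝ) : ℝ :=
  Gam eps i j k x - Gam eps i k j x

/-- A vector field `ξ` is `ε`-parallel if `ξ^i(y) = ε^i_a(x,y) ξ^a(x)` for all `x, y ∈ U`. -/
def EpsParallelVF {n : ℕ} (U : Set (Fin n → ℝ))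
    (eps : (Fin n → ℝ) → (Fin n → ℝ) → Fin n → Fin n → ℝ)
    (ξ : (Fin n → ℝ) → Fin n → ℝ) : Prop :=
  ∀ x ∈ U, ∀ y ∈ U, ∀ i, ξ y i = ∑ a, eps x y i a * ξ x a

/-- The slice `y ↦ ε(p,y)` of a splitting is differentiable at every point of `U`. -/
theorem IsSplitting.differentiableAt_right {n : ℕ} {U : Set (Fin n → ℝ)} (hU : IsOpen U)
    {eps : (Fin n → ℝ) → (Fin n → ℝ) → Fin n → Fin n → ℝ} (heps : IsSplitting U eps)
    {p x : Fin n → ℝ} (hp : p ∈ U) (hx : x ∈ U) (i a : Fin n) :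
    DifferentiableAt ℝ (fun y => eps p y i a) x := by
  have h : DifferentiableAt ℝ (fun q : (Fin n → ℝ) × (Fin n → ℝ) => eps q.1 q.2 i a) (p, x) :=
    ((heps.smooth i a).contDiffAt ((hU.prod hU).mem_nhds ⟨hp, hx⟩)).differentiableAt (by simp)
  exact h.comp x ((differentiableAt_const p).prodMk differentiableAt_id)

/-- `ε^a_k(x,p)·(∂ε^i_a(p,y)/∂y^j)|_{y=x} = Γ^i_{jk}(x)`; in particular the
left-hand side does not depend on the basepoint `p`. -/
theorem stmt_5 {n : ℕ} (hn : 2 ≤ n) (U : Set (Fin n → ℝ)) (hU : IsOpen U)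
    (eps : (Fin n → ℝ) → (Fin n → ℝ) → Fin n → Fin n → ℝ) (heps : IsSplitting U eps) :
    ∀ p ∈ U, ∀ x ∈ U, ∀ i j k : Fin n,
      ∑ a, eps x p a k * pd j (fun y => eps p y i a) x = Gam eps i j k x := by
  intro p hp x hx i j k
  have hd a := heps.differentiableAt_right hU hp hx i a
  have heq : (fun y => eps x y i k) =ᶠ[nhds x] fun y => ∑ a, eps p y i a * eps x p a k := by
    filter_upwards [hU.mem_nhds hx] with y hy
    exact (heps.comp x hx y hy p hp i k).symm
  unfold Gam pd
  rw [heq.fderiv_eq, fderiv_fun_sum fun a _ => (hd a).mul_const _]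
  simp only [sum_apply]
  refine Finset.sum_congr rfl fun a _ => ?_
  rw [fderiv_mul_const (hd a)]
  simp
end
end

section
/- Let ε be a splitting on a connected open set U ⊆ ℝⁿ. Then the following are equivalent: (i) for all ε-parallel vector fields ξ, η on U, the Lie bracket [ξ,η], defined by [ξ,η]^i = ξ^a ∂η^i/∂x^a − η^a ∂ξ^i/∂x^a, is again ε-parallel (i.e. the ε-parallel vector fields form a Lie algebra under the bracket); (ii) the algebroid curvature 𝔯 vanishes identically on U. -/
noncomputable section

open Set

/-- The Lie bracket `[ξ,η]^i = ξ^a ∂η^i/∂x^a − η^a ∂ξ^i/∂x^a` of two vector fields. -/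
noncomputable def vbr {n : ℕ} (ξ η : (Fin n → ℝ) → Fin n → ℝ)
    (x : Fin n → ℝ) (i : Fin n) : ℝ :=
  ∑ a, ξ x a * pd a (fun x' => η x' i) x - ∑ a, η x a * pd a (fun x' => ξ x' i) x

section PartialDerivatives

variable {n : ℕ}

theorem pd_congr {f g : (Fin n → ℝ) → ℝ} {x : Fin n → ℝ} {U : Set (Fin n → ℝ)}
    (hU : IsOpen U) (hx : x ∈ U) (h : ∀ y ∈ U, f y = g y) (j : Fin n) :
    pd j f x = pd j g x := by
  have : f =ᶠ[nhds x] g := Filter.eventuallyEq_of_mem (hU.mem_nhds hx) h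
  rw [pd, pd, this.fderiv_eq]

theorem pd_sub {f g : (Fin n → ℝ) → ℝ} {x : Fin n → ℝ}
    (hf : DifferentiableAt ℝ f x) (hg : DifferentiableAt ℝ g x) (j : Fin n) :
    pd j (fun y => f y - g y) x = pd j f x - pd j g x := by
  simp only [pd]
  rw [fderiv_fun_sub hf hg]
  rfl

theorem pd_sum_mul {f g : Fin n → (Fin n → ℝ) → ℝ} {x : Fin n → ℝ}
    (hf : ∀ a, DifferentiableAt ℝ (f a) x) (hg : ∀ a, DifferentiableAt ℝ (g a) x) (j : Fin n) :
    pd j (fun y => ∑ a, f a y * g a y) x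
      = ∑ a, pd j (f a) x * g a x + ∑ a, f a x * pd j (g a) x := by
  simp only [pd]
  rw [fderiv_fun_sum fun a _ => (hf a).fun_mul (hg a), ← Finset.sum_add_distrib,
    sum_apply]
  refine Finset.sum_congr rfl fun a _ => ?_
  rw [fderiv_fun_mul (hf a) (hg a)]
  simp only [add_apply, smul_apply, smul_eq_mul]
  ring

theorem pd_sum_mul_const {f : Fin n → (Fin n → ℝ) → ℝ} {x : Fin n → ℝ}
    (hf : ∀ a, DifferentiableAt ℝ (f a) x) (c : Fin n → ℝ) (j : Fin n) :
    pd j (fun y => ∑ a, f a y * c a) x = ∑ a, pd j (f a) x * c a := by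
  rw [pd_sum_mul hf (fun a => differentiableAt_const (c a))]
  simp [pd]

theorem contDiffAt_pd {f : (Fin n → ℝ) → ℝ} {x : Fin n → ℝ}
    (hf : ContDiffAt ℝ (⊤ : ℕ∞) f x) (j : Fin n) : ContDiffAt ℝ (⊤ : ℕ∞) (pd j f) x :=
  (hf.fderiv_right (m := (⊤ : ℕ∞)) le_rfl).clm_apply contDiffAt_const

theorem pd_pd_apply {f : (Fin n → ℝ) → ℝ} {x : Fin n → ℝ}
    (hf : ContDiffAt ℝ (⊤ : ℕ∞) f x) (j k : Fin n) :
    pd j (pd k f) x = fderiv ℝ (fderiv ℝ f) x (Pi.single j 1) (Pi.single k 1) := by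
  have h : DifferentiableAt ℝ (fderiv ℝ f) x :=
    (hf.fderiv_right (m := (⊤ : ℕ∞)) le_rfl).differentiableAt (by simp)
  change fderiv ℝ (fun y => fderiv ℝ f y (Pi.single k 1)) x (Pi.single j 1) = _
  rw [fderiv_clm_apply h (differentiableAt_const _)]
  simp

theorem pd_comm {f : (Fin n → ℝ) → ℝ} {x : Fin n → ℝ}
    (hf : ContDiffAt ℝ (⊤ : ℕ∞) f x) (j k : Fin n) :
    pd j (pd k f) x = pd k (pd j f) x := by
  rw [pd_pd_apply hf, pd_pd_apply hf]
  exact hf.isSymmSndFDerivAt (by simpa using WithTop.coe_le_coe.mpr (le_top (a := (2 : ℕ∞)))) _ _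

theorem fderiv_eq_zero_of_pd {f : (Fin n → ℝ) → ℝ} {x : Fin n → ℝ}
    (h : ∀ j, pd j f x = 0) : fderiv ℝ f x = 0 := by
  apply ContinuousLinearMap.coe_injective
  apply LinearMap.pi_ext'
  intro j
  ext
  simpa [pd] using h j

end PartialDerivatives

section Splitting

variable {n : ℕ} {U : Set (Fin n → ℝ)} {eps : (Fin n → ℝ) → (Fin n → ℝ) → Fin n → Fin n → ℝ}

theorem IsSplitting.contDiffAt_right (heps : IsSplitting U eps) (hU : IsOpen U)
    {x y : Fin n → ℝ} (hx : x ∈ U) (hy : y ∈ U) (i j : Fin n) :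
    ContDiffAt ℝ (⊤ : ℕ∞) (fun y' => eps x y' i j) y :=
  ((heps.smooth i j).contDiffAt ((hU.prod hU).mem_nhds ⟨hx, hy⟩)).comp y
    (contDiffAt_const.prodMk contDiffAt_id)

theorem IsSplitting.contDiffAt_left (heps : IsSplitting U eps) (hU : IsOpen U)
    {x y : Fin n → ℝ} (hx : x ∈ U) (hy : y ∈ U) (i j : Fin n) :
    ContDiffAt ℝ (⊤ : ℕ∞) (fun x' => eps x' y i j) x :=
  ((heps.smooth i j).contDiffAt ((hU.prod hU).mem_nhds ⟨hx, hy⟩)).comp x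
    (contDiffAt_id.prodMk contDiffAt_const)

theorem IsSplitting.sum_refl (heps : IsSplitting U eps) {x : Fin n → ℝ} (hx : x ∈ U)
    (v : Fin n → ℝ) (i : Fin n) : ∑ a, eps x x i a * v a = v i := by
  simp [heps.refl x hx]

theorem IsSplitting.sum_comp (heps : IsSplitting U eps) {x y z : Fin n → ℝ} (hx : x ∈ U)
    (hy : y ∈ U) (hz : z ∈ U) (v : Fin n → ℝ) (i : Fin n) :
    ∑ a, eps z y i a * ∑ b, eps x z a b * v b = ∑ b, eps x y i b * v b := by
  simp only [← heps.comp x hx y hy z hz, Finset.mul_sum, Finset.sum_mul]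
  rw [Finset.sum_comm]
  simp only [mul_assoc]

theorem IsSplitting.differentiableAt_gam (heps : IsSplitting U eps) (hU : IsOpen U)
    {x : Fin n → ℝ} (hx : x ∈ U) (i j k : Fin n) :
    DifferentiableAt ℝ (Gam eps i j k) x := by
  have h : ∀ y ∈ U, Gam eps i j k y
      = ∑ a, pd j (fun y' => eps x y' i a) y * eps y x a k := by
    intro y hy
    rw [← pd_sum_mul_const
      (fun a => (heps.contDiffAt_right hU hx hy i a).differentiableAt (by simp))]
    exact pd_congr hU hy (fun z hz => (heps.comp y hy z hz x hx i k).symm) j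
  refine DifferentiableAt.congr_of_eventuallyEq ?_
    (Filter.eventuallyEq_of_mem (hU.mem_nhds hx) h)
  refine DifferentiableAt.fun_sum fun a _ => DifferentiableAt.mul ?_ ?_
  · exact (contDiffAt_pd (heps.contDiffAt_right hU hx hx i a) j).differentiableAt (by simp)
  · exact (heps.contDiffAt_left hU hx hx a k).differentiableAt (by simp)

theorem EpsParallelVF.contDiffAt (heps : IsSplitting U eps) (hU : IsOpen U)
    {ξ : (Fin n → ℝ) → Fin n → ℝ} (hξ : EpsParallelVF U eps ξ) {x : Fin n → ℝ} (hx : x ∈ U)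
    (i : Fin n) : ContDiffAt ℝ (⊤ : ℕ∞) (fun y => ξ y i) x := by
  refine ContDiffAt.congr_of_eventuallyEq ?_
    (Filter.eventuallyEq_of_mem (hU.mem_nhds hx) fun y hy => hξ x hx y hy i)
  exact ContDiffAt.sum fun a _ => (heps.contDiffAt_right hU hx hx i a).mul contDiffAt_const

theorem EpsParallelVF.pd_eq (heps : IsSplitting U eps) (hU : IsOpen U)
    {ξ : (Fin n → ℝ) → Fin n → ℝ} (hξ : EpsParallelVF U eps ξ) {x : Fin n → ℝ} (hx : x ∈ U)
    (r i : Fin n) : pd r (fun y => ξ y i) x = ∑ k, Gam eps i r k x * ξ x k := by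
  rw [pd_congr hU hx (fun y hy => hξ x hx y hy i) r, pd_sum_mul_const
    (fun a => (heps.contDiffAt_right hU hx hx i a).differentiableAt (by simp))]
  rfl

theorem IsSplitting.epsParallelVF_transport (heps : IsSplitting U eps) {x : Fin n → ℝ}
    (hx : x ∈ U) (v : Fin n → ℝ) :
    EpsParallelVF U eps (fun y i => ∑ a, eps x y i a * v a) :=
  fun _ hy _ hz i => (heps.sum_comp hx hz hy v i).symm

/-- On a connected open set, a differentiable solution of `∂_r ξ = Γ_r ξ` is parallel. -/
theorem IsSplitting.epsParallelVF_of_pd_eq (heps : IsSplitting U eps) (hU : IsOpen U)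
    (hUc : IsPreconnected U) {ξ : (Fin n → ℝ) → Fin n → ℝ}
    (hd : ∀ x ∈ U, ∀ i, DifferentiableAt ℝ (fun y => ξ y i) x)
    (h : ∀ x ∈ U, ∀ r i, pd r (fun y => ξ y i) x = ∑ k, Gam eps i r k x * ξ x k) :
    EpsParallelVF U eps ξ := by
  intro x hx y hy i
  have hl : ∀ z ∈ U, ∀ w ∈ U, ∀ i, DifferentiableAt ℝ (fun z' => ∑ a, eps z' w i a * ξ z' a) z :=
    fun z hz w hw i => DifferentiableAt.fun_sum fun a _ =>
      ((heps.contDiffAt_left hU hz hw i a).differentiableAt (by simp)).mul (hd z hz a)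
  have hstat : ∀ z ∈ U, ∀ r i, pd r (fun z' => ∑ a, eps z' z i a * ξ z' a) z = 0 := by
    intro z hz r i
    have h1 := h z hz r i
    rw [pd_congr (g := fun z' => ∑ a, eps z z' i a * ∑ b, eps z' z a b * ξ z' b) hU hz
      (fun z' hz' => by rw [heps.sum_comp hz' hz' hz, heps.sum_refl hz']) r,
      pd_sum_mul (fun a => (heps.contDiffAt_right hU hz hz i a).differentiableAt (by simp))
        (fun a => hl z hz z hz a), heps.sum_refl hz] at h1
    simp only [heps.sum_refl hz] at h1
    exact add_eq_left.mp h1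
  have hconst : ∀ a, ∑ b, eps y x a b * ξ y b = ξ x a := by
    intro a
    have hf : ∀ z ∈ U, fderiv ℝ (fun z' => ∑ b, eps z' x a b * ξ z' b) z = 0 := by
      intro z hz
      refine fderiv_eq_zero_of_pd fun r => ?_
      rw [pd_congr (g := fun z' => ∑ c, eps z x a c * ∑ b, eps z' z c b * ξ z' b) hU hz
        (fun z' hz' => (heps.sum_comp hz' hx hz _ a).symm) r,
        pd_sum_mul (fun c => differentiableAt_const _) (fun c => hl z hz z hz c)]
      simp only [hstat z hz]
      simp [pd]
    have := hU.is_const_of_fderiv_eq_zero hUc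
      (fun z hz => (hl z hz x hx a).differentiableWithinAt) hf hy hx
    simpa only [heps.sum_refl hx] using this
  simp only [← hconst]
  rw [heps.sum_comp hy hy hx, heps.sum_refl hy]

theorem EpsParallelVF.differentiableAt_sum_mul_pd (heps : IsSplitting U eps) (hU : IsOpen U)
    {ξ η : (Fin n → ℝ) → Fin n → ℝ} (hξ : EpsParallelVF U eps ξ) (hη : EpsParallelVF U eps η)
    {x : Fin n → ℝ} (hx : x ∈ U) (i : Fin n) :
    DifferentiableAt ℝ (fun y => ∑ a, ξ y a * pd a (fun x' => η x' i) y) x :=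
  DifferentiableAt.fun_sum fun a _ =>
    ((hξ.contDiffAt heps hU hx a).differentiableAt (by simp)).mul
      ((contDiffAt_pd (hη.contDiffAt heps hU hx i) a).differentiableAt (by simp))

theorem EpsParallelVF.pd_sum_mul_pd (heps : IsSplitting U eps) (hU : IsOpen U)
    {ξ η : (Fin n → ℝ) → Fin n → ℝ} (hξ : EpsParallelVF U eps ξ) (hη : EpsParallelVF U eps η)
    {x : Fin n → ℝ} (hx : x ∈ U) (r i : Fin n) :
    pd r (fun y => ∑ a, ξ y a * pd a (fun x' => η x' i) y) x
      = ∑ j, ∑ k, (∑ a, Gam eps a r j x * Gam eps i a k x + pd j (Gam eps i r k) x)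
          * (ξ x j * η x k)
        + ∑ b, Gam eps i r b x * ∑ a, ξ x a * pd a (fun x' => η x' b) x := by
  have hξd := fun a => (hξ.contDiffAt heps hU hx a).differentiableAt (by simp)
  have hηd := fun a => (hη.contDiffAt heps hU hx a).differentiableAt (by simp)
  have hsec : ∀ a, pd r (pd a (fun x' => η x' i)) x
      = ∑ k, pd a (Gam eps i r k) x * η x k
        + ∑ k, Gam eps i r k x * pd a (fun x' => η x' k) x := by
    intro a
    rw [pd_comm (hη.contDiffAt heps hU hx i),
      pd_congr hU hx (fun y hy => hη.pd_eq heps hU hy r i) a,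
      pd_sum_mul (fun k => heps.differentiableAt_gam hU hx i r k) hηd]
  have hfirst : ∑ a, pd r (fun y => ξ y a) x * pd a (fun x' => η x' i) x
      = ∑ j, ∑ k, (∑ a, Gam eps a r j x * Gam eps i a k x) * (ξ x j * η x k) := by
    simp only [hξ.pd_eq heps hU hx, hη.pd_eq heps hU hx, Finset.sum_mul_sum]
    rw [Finset.sum_comm]
    refine Finset.sum_congr rfl fun j _ => ?_
    rw [Finset.sum_comm]
    refine Finset.sum_congr rfl fun k _ => ?_
    rw [Finset.sum_mul]
    exact Finset.sum_congr rfl fun a _ => by ring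
  have hsecond : ∑ b, Gam eps i r b x * ∑ a, ξ x a * pd a (fun x' => η x' b) x
      = ∑ a, ξ x a * ∑ k, Gam eps i r k x * pd a (fun x' => η x' k) x := by
    simp only [Finset.mul_sum]
    rw [Finset.sum_comm]
    exact Finset.sum_congr rfl fun a _ => Finset.sum_congr rfl fun k _ => by ring
  rw [pd_sum_mul hξd
    (fun a => (contDiffAt_pd (hη.contDiffAt heps hU hx i) a).differentiableAt (by simp)),
    hfirst, hsecond]
  simp only [hsec, mul_add, add_mul, Finset.sum_add_distrib, ← add_assoc]
  congr 2
  refine Finset.sum_congr rfl fun j _ => ?_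
  rw [Finset.mul_sum]
  exact Finset.sum_congr rfl fun k _ => by ring

/-- The algebroid curvature is the covariant derivative of the bracket of parallel fields. -/
theorem EpsParallelVF.pd_vbr (heps : IsSplitting U eps) (hU : IsOpen U)
    {ξ η : (Fin n → ℝ) → Fin n → ℝ} (hξ : EpsParallelVF U eps ξ) (hη : EpsParallelVF U eps η)
    {x : Fin n → ℝ} (hx : x ∈ U) (r i : Fin n) :
    pd r (fun y => vbr ξ η y i) x
      = ∑ j, ∑ k, ra eps i j k r x * (ξ x j * η x k) + ∑ a, Gam eps i r a x * vbr ξ η x a := by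
  simp only [vbr]
  rw [pd_sub (hξ.differentiableAt_sum_mul_pd heps hU hη hx i)
    (hη.differentiableAt_sum_mul_pd heps hU hξ hx i),
    hξ.pd_sum_mul_pd heps hU hη hx, hη.pd_sum_mul_pd heps hU hξ hx]
  have hra : ∑ j, ∑ k, ra eps i j k r x * (ξ x j * η x k)
      = ∑ j, ∑ k, (∑ a, Gam eps a r j x * Gam eps i a k x + pd j (Gam eps i r k) x)
          * (ξ x j * η x k)
        - ∑ j, ∑ k, (∑ a, Gam eps a r j x * Gam eps i a k x + pd j (Gam eps i r k) x)
          * (η x j * ξ x k) := by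
    conv_rhs =>
      arg 2
      rw [Finset.sum_comm]
    simp only [← Finset.sum_sub_distrib]
    refine Finset.sum_congr rfl fun j _ => Finset.sum_congr rfl fun k _ => ?_
    rw [ra]
    ring
  rw [hra]
  simp only [mul_sub, Finset.sum_sub_distrib]
  ring

end Splitting

/-- The `ε`-parallel vector fields on a connected open `U` are closed under
the Lie bracket iff the algebroid curvature `𝔯` vanishes identically on `U`. -/
theorem stmt_6 {n : ℕ} (hn : 2 ≤ n) (U : Set (Fin n → ℝ)) (hU : IsOpen U)
    (hUconn : IsConnected U)
    (eps : (Fin n → ℝ) → (Fin n → ℝ) → Fin n → Fin n → ℝ) (heps : IsSplitting U eps) :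
    (∀ ξ η : (Fin n → ℝ) → Fin n → ℝ, EpsParallelVF U eps ξ → EpsParallelVF U eps η →
        EpsParallelVF U eps (fun x i => vbr ξ η x i)) ↔
      (∀ x ∈ U, ∀ i j k r : Fin n, ra eps i j k r x = 0) := by
  constructor
  · intro h x hx i j k r
    have hξ := heps.epsParallelVF_transport hx (Pi.single j 1)
    have hη := heps.epsParallelVF_transport hx (Pi.single k 1)
    have hbr := (h _ _ hξ hη).pd_eq heps hU hx r i
    rw [hξ.pd_vbr heps hU hη hx, add_eq_right] at hbr
    simp only [heps.sum_refl hx] at hbr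
    simpa [Pi.single_apply] using hbr
  · intro h ξ η hξ hη
    refine heps.epsParallelVF_of_pd_eq hU hUconn.isPreconnected (fun x hx i => ?_)
      (fun x hx r i => ?_)
    · exact (hξ.differentiableAt_sum_mul_pd heps hU hη hx i).sub
        (hη.differentiableAt_sum_mul_pd heps hU hξ hx i)
    · rw [hξ.pd_vbr heps hU hη hx]
      simp [h x hx]
end
end
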